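/- Coercivity of the linearized Fokker–Planck operator: for every γ>0 there exists a constant ν₀>0 such that for every smooth, rapidly decaying g:ℝ³→ℝ one has ⟨−Lg,g⟩_{L²_v} = −∫_{ℝ³}(Lg)(v) g(v) dv ≥ ν₀ |P₁g|²_{L²_σ}, where |h|²_{L²_σ} = ∫_{ℝ³}⟨v⟩^{2(γ−1)}|h|² dv + ∫_{ℝ³}|∇_v h|² dv. -/

import Mathlib

open MeasureTheory Real
open scoped RealInnerProductSpace

noncomputable section

abbrev V3 := EuclideanSpace ℝ (Fin 3)

/-- Japanese bracket `⟨v⟩ = (1+|v|²)^{1/2}`. -/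
def jap (v : V3) : ℝ := Real.sqrt (1 + ‖v‖ ^ 2)

/-- Laplacian in the velocity variable. -/
def lap (g : V3 → ℝ) (v : V3) : ℝ :=
  ∑ i : Fin 3,
    fderiv ℝ (fun w => fderiv ℝ g w (EuclideanSpace.single i 1)) v (EuclideanSpace.single i 1)

/-- The potential `Φ(v) = (1/γ)⟨v⟩^γ + Φ₀`. -/
def Phi (γ Φ0 : ℝ) (v : V3) : ℝ := (1 / γ) * jap v ^ γ + Φ0

/-- `M(v)^{1/2} = exp(-Φ(v)/2)`. -/
def sqrtM (γ Φ0 : ℝ) (v : V3) : ℝ := Real.exp (-(Phi γ Φ0 v) / 2)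

/-- The linearized Fokker–Planck operator. -/
def Lop (γ : ℝ) (g : V3 → ℝ) (v : V3) : ℝ :=
  lap g v +
    (-(1 / 4) * ‖v‖ ^ 2 * jap v ^ (2 * γ - 4) +
      ((3 / 2) * jap v ^ (γ - 2) + ((γ - 2) / 2) * ‖v‖ ^ 2 * jap v ^ (γ - 4))) * g v

/-- Macroscopic projection `P₀`. -/
def P0 (γ Φ0 : ℝ) (g : V3 → ℝ) (v : V3) : ℝ :=
  (∫ w : V3, g w * sqrtM γ Φ0 w) * sqrtM γ Φ0 v

/-- Microscopic projection `P₁ = Id - P₀`. -/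
def P1 (γ Φ0 : ℝ) (g : V3 → ℝ) (v : V3) : ℝ := g v - P0 γ Φ0 g v

/-- A smooth non-increasing cutoff, `χ = 1` on `(-∞,1]`, `χ = 0` on `[2,∞)`. -/
structure IsCutoff (χ : ℝ → ℝ) : Prop where
  smooth : ContDiff ℝ (⊤ : ℕ∞) χ
  anti : Antitone χ
  eq_one : ∀ s : ℝ, s ≤ 1 → χ s = 1
  eq_zero : ∀ s : ℝ, 2 ≤ s → χ s = 0
  nonneg : ∀ s : ℝ, 0 ≤ χ s
  le_one : ∀ s : ℝ, χ s ≤ 1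

/-- `K g = ϖ χ_R(|v|) g`. -/
def Kop (ϖ R : ℝ) (χ : ℝ → ℝ) (g : V3 → ℝ) (v : V3) : ℝ := ϖ * χ (‖v‖ / R) * g v

/-- `Λ g = -L g + ϖ χ_R(|v|) g`. -/
def Lam (γ ϖ R : ℝ) (χ : ℝ → ℝ) (g : V3 → ℝ) (v : V3) : ℝ :=
  -(Lop γ g v) + Kop ϖ R χ g v

/-- Rapid decay (together with all derivatives) in the `(x,v)` variables. -/
def RapidDecay (g : V3 → V3 → ℝ) : Prop :=
  ∀ k n : ℕ, ∃ C : ℝ, ∀ x v : V3,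
    (1 + ‖x‖ + ‖v‖) ^ k * ‖iteratedFDeriv ℝ n (fun p : V3 × V3 => g p.1 p.2) (x, v)‖ ≤ C

/-- Smooth rapidly-decaying solution of `∂ₜ h + v·∇ₓ h + Λ h = src`. -/
def IsDampedSol (γ ϖ R : ℝ) (χ : ℝ → ℝ) (src : ℝ → V3 → V3 → ℝ)
    (h : ℝ → V3 → V3 → ℝ) : Prop :=
  ContDiff ℝ (⊤ : ℕ∞) (fun p : ℝ × V3 × V3 => h p.1 p.2.1 p.2.2) ∧
  (∀ t : ℝ, RapidDecay (h t)) ∧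
  ∀ (t : ℝ) (x v : V3),
    deriv (fun s => h s x v) t +
        (∑ i : Fin 3, v i * fderiv ℝ (fun y => h t y v) x (EuclideanSpace.single i 1)) +
        Lam γ ϖ R χ (fun w => h t x w) v = src t x v

/-- The wave approximations `h⁽⁰⁾,…,h⁽³⁾` from initial data `f₀`. -/
def IsWaveSeq (γ ϖ R : ℝ) (χ : ℝ → ℝ) (f0 : V3 → V3 → ℝ)
    (h : ℕ → ℝ → V3 → V3 → ℝ) : Prop :=
  IsDampedSol γ ϖ R χ (fun _ _ _ => 0) (h 0) ∧ (∀ x v : V3, h 0 0 x v = f0 x v) ∧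
  ∀ j : ℕ, 1 ≤ j → j ≤ 3 →
    IsDampedSol γ ϖ R χ (fun t x v => Kop ϖ R χ (fun w => h (j - 1) t x w) v) (h j) ∧
    ∀ x v : V3, h j 0 x v = 0

/-- Smooth rapidly-decaying solution of the Fokker–Planck equation `∂ₜ f + v·∇ₓ f = L f`. -/
def IsFPSol (γ : ℝ) (f0 : V3 → V3 → ℝ) (f : ℝ → V3 → V3 → ℝ) : Prop :=
  ContDiff ℝ (⊤ : ℕ∞) (fun p : ℝ × V3 × V3 => f p.1 p.2.1 p.2.2) ∧
  (∀ t : ℝ, RapidDecay (f t)) ∧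
  (∀ x v : V3, f 0 x v = f0 x v) ∧
  ∀ (t : ℝ) (x v : V3),
    deriv (fun s => f s x v) t +
        (∑ i : Fin 3, v i * fderiv ℝ (fun y => f t y v) x (EuclideanSpace.single i 1)) =
      Lop γ (fun w => f t x w) v

/-- Weight function `c(x,v)`. -/
def cW (γ δ : ℝ) (χ : ℝ → ℝ) (x v : V3) : ℝ :=
  5 * (δ * jap x) ^ (γ / (3 - γ)) * (1 - χ (δ * jap x * jap v ^ (γ - 3))) +
    ((1 - χ (δ * jap x * jap v ^ (γ - 3))) * (δ * jap x) * jap v ^ (2 * γ - 3) +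
        3 * jap v ^ γ) *
      χ (δ * jap x * jap v ^ (γ - 3))

/-- Weighted `L²` norm. -/
def L2W (μ g : V3 → V3 → ℝ) : ℝ :=
  Real.sqrt (∫ x : V3, ∫ v : V3, g x v ^ 2 * μ x v)

/-- Weighted `L²_σ` square norm. -/
def sigmaSq (γ : ℝ) (μ g : V3 → V3 → ℝ) : ℝ :=
  ∫ x : V3, ∫ v : V3,
    (jap v ^ (2 * (γ - 1)) * g x v ^ 2 + ‖gradient (g x) v‖ ^ 2) * μ x v

/-- Partial derivative in the space variable in direction `i`. -/
def pxd (i : Fin 3) (g : V3 → V3 → ℝ) : V3 → V3 → ℝ :=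
  fun x v => fderiv ℝ (fun y => g y v) x (EuclideanSpace.single i 1)

/-- Iterated spatial partial derivatives. -/
def pxds : List (Fin 3) → (V3 → V3 → ℝ) → V3 → V3 → ℝ
  | [], g => g
  | i :: l, g => pxd i (pxds l g)

/-- Weighted `H^k_x L²_v` norm. -/
def HkW (μ : V3 → V3 → ℝ) (k : ℕ) (g : V3 → V3 → ℝ) : ℝ :=
  ∑ n ∈ Finset.range (k + 1), ∑ d : Fin n → Fin 3,
    Real.sqrt (∫ x : V3, ∫ v : V3, pxds (List.ofFn d) g x v ^ 2 * μ x v)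

/-- Weighted `L²` norm of all `x`-derivatives of order exactly `k`. -/
def NxkW (μ : V3 → V3 → ℝ) (k : ℕ) (g : V3 → V3 → ℝ) : ℝ :=
  Real.sqrt (∑ d : Fin k → Fin 3,
    ∫ x : V3, ∫ v : V3, pxds (List.ofFn d) g x v ^ 2 * μ x v)

lemma sq_integral_le (φ : ℝ → ℝ) (hφ : Continuous φ) :
    (∫ t in (0:ℝ)..1, φ t) ^ 2 ≤ ∫ t in (0:ℝ)..1, φ t ^ 2 := by
  set m := ∫ t in (0:ℝ)..1, φ t with hm
  have h0 : 0 ≤ ∫ t in (0:ℝ)..1, (φ t - m) ^ 2 :=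
    intervalIntegral.integral_nonneg (by norm_num) (fun t _ => sq_nonneg _)
  have h1 : ∫ t in (0:ℝ)..1, (φ t - m) ^ 2 = (∫ t in (0:ℝ)..1, φ t ^ 2) - 2 * m * m + m ^ 2 := by
    have : ∀ t, (φ t - m) ^ 2 = φ t ^ 2 - 2 * m * φ t + m ^ 2 := fun t => by ring
    simp_rw [this]
    rw [intervalIntegral.integral_add, intervalIntegral.integral_sub,
      intervalIntegral.integral_const_mul, ← hm]
    · simp
    all_goals exact Continuous.intervalIntegrable (by fun_prop) _ _
  nlinarith

lemma seg_ineq (f : V3 → ℝ) (hf : ContDiff ℝ 1 f) (x y : V3) :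
    (f x - f y) ^ 2 ≤ ‖y - x‖ ^ 2 * ∫ t in (0:ℝ)..1, ‖fderiv ℝ f ((1 - t) • x + t • y)‖ ^ 2 := by
  have hd : Continuous (fderiv ℝ f) := hf.continuous_fderiv (by norm_num)
  set φ : ℝ → ℝ := fun t => fderiv ℝ f ((1 - t) • x + t • y) (y - x) with hφ
  have hc : Continuous φ := by
    rw [hφ]
    exact Continuous.clm_apply (hd.comp (by fun_prop)) continuous_const
  have hder : ∀ t : ℝ, HasDerivAt (fun t : ℝ => f ((1 - t) • x + t • y)) (φ t) t := by
    intro t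
    have h1 : HasDerivAt (fun t : ℝ => (1 - t) • x + t • y) (y - x) t := by
      have := (((hasDerivAt_id t).const_sub 1).smul_const x).add ((hasDerivAt_id t).smul_const y)
      have e : y - x = (-1 : ℝ) • x + (1 : ℝ) • y := by module
      rw [e]; exact this
    exact ((hf.differentiable (by norm_num)).differentiableAt.hasFDerivAt).comp_hasDerivAt t h1
  have hftc : ∫ t in (0:ℝ)..1, φ t = f y - f x := by
    rw [intervalIntegral.integral_eq_sub_of_hasDerivAt (fun t _ => hder t)
      (hc.intervalIntegrable _ _)]
    simp
  calc (f x - f y) ^ 2 = (∫ t in (0:ℝ)..1, φ t) ^ 2 := by rw [hftc]; ring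
    _ ≤ ∫ t in (0:ℝ)..1, φ t ^ 2 := sq_integral_le φ hc
    _ ≤ ∫ t in (0:ℝ)..1, ‖y - x‖ ^ 2 * ‖fderiv ℝ f ((1 - t) • x + t • y)‖ ^ 2 := by
        apply intervalIntegral.integral_mono_on (by norm_num)
        · exact (hc.pow 2).intervalIntegrable _ _
        · apply Continuous.intervalIntegrable
          exact continuous_const.mul ((hd.comp (by fun_prop)).norm.pow 2)
        · intro t _
          have := (fderiv ℝ f ((1 - t) • x + t • y)).le_opNorm (y - x)
          rw [← mul_pow, ← sq_abs, mul_comm]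
          exact pow_le_pow_left₀ (abs_nonneg _) this 2
    _ = _ := by rw [intervalIntegral.integral_const_mul]

lemma lint_aff (F : V3 → ENNReal) (hF : Measurable F) (s : ℝ) (hs : 1/2 ≤ s) (a : V3) :
    ∫⁻ x, F (s • x + a) ≤ 8 * ∫⁻ x, F x := by
  have hs0 : s ≠ 0 := by intro h; norm_num [h] at hs
  have h1 : ∫⁻ x, F (s • x + a) = ∫⁻ z, F (z + a) ∂(Measure.map (fun x : V3 => s • x) volume) := by
    rw [lintegral_map (by fun_prop) (by fun_prop)]
  rw [h1, Measure.map_addHaar_smul _ hs0, lintegral_smul_measure, lintegral_add_right_eq_self,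
    smul_eq_mul]
  gcongr
  rw [show (8:ENNReal) = ENNReal.ofReal 8 by norm_num]
  apply ENNReal.ofReal_le_ofReal
  have h2 : (0:ℝ) < s := by linarith
  rw [abs_of_pos (by positivity)]
  simp only [finrank_euclideanSpace, Fintype.card_fin]
  rw [inv_le_comm₀ (by positivity) (by norm_num)]
  calc (8:ℝ)⁻¹ = (1/2)^3 := by norm_num
    _ ≤ s ^ 3 := pow_le_pow_left₀ (by norm_num) hs 3

lemma lint_double (F : V3 → ENNReal) (hF : Measurable F) (B : Set V3)
    (t : ℝ) :
    ∫⁻ x in B, ∫⁻ y in B, F ((1 - t) • x + t • y) ≤ 8 * volume B * ∫⁻ x, F x := by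
  rcases le_total t (1/2) with h | h
  · rw [lintegral_lintegral_swap (by
      apply Measurable.aemeasurable
      apply hF.comp
      fun_prop)]
    calc ∫⁻ y in B, ∫⁻ x in B, F ((1 - t) • x + t • y)
        ≤ ∫⁻ y in B, 8 * ∫⁻ x, F x := by
          gcongr with y
          exact (setLIntegral_le_lintegral _ _).trans (lint_aff F hF _ (by linarith) _)
      _ = _ := by rw [setLIntegral_const]; ring
  · calc ∫⁻ x in B, ∫⁻ y in B, F ((1 - t) • x + t • y)
        ≤ ∫⁻ x in B, 8 * ∫⁻ x, F x := by
          gcongr with x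
          simp_rw [add_comm ((1 - t) • x)]
          exact (setLIntegral_le_lintegral _ _).trans (lint_aff F hF _ (by linarith) _)
      _ = _ := by rw [setLIntegral_const]; ring

lemma poinc (R : ℝ) (hR : 0 < R) (f : V3 → ℝ) (hf : ContDiff ℝ 1 f) :
    ∃ c : ℝ, ∫⁻ x in Metric.closedBall (0:V3) R, ENNReal.ofReal ((f x - c) ^ 2) ≤
      ENNReal.ofReal (32 * R ^ 2) *
        ∫⁻ x in Metric.closedBall (0:V3) R, ENNReal.ofReal (‖fderiv ℝ f x‖ ^ 2) := by
  set B := Metric.closedBall (0:V3) R with hB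
  have hBm : MeasurableSet B := Metric.isClosed_closedBall.measurableSet
  have hd : Continuous (fderiv ℝ f) := hf.continuous_fderiv (by norm_num)
  have hfc : Continuous f := hf.continuous
  set G : V3 → ENNReal := fun x => ENNReal.ofReal (‖fderiv ℝ f x‖ ^ 2) with hG
  have hGm : Measurable G := by
    apply Continuous.measurable
    exact ENNReal.continuous_ofReal.comp (hd.norm.pow 2)
  set F : V3 → ENNReal := B.indicator G with hFdef
  have hF : Measurable F := hGm.indicator hBm
  have hFint : ∫⁻ x, F x = ∫⁻ x in B, G x := lintegral_indicator hBm _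
  have hpt : ∀ x ∈ B, ∀ y ∈ B, ENNReal.ofReal ((f y - f x) ^ 2) ≤
      ENNReal.ofReal (4 * R ^ 2) * ∫⁻ t in Set.Ioc (0:ℝ) 1, F ((1 - t) • x + t • y) := by
    intro x hx y hy
    have h1 := seg_ineq f hf x y
    have hint : 0 ≤ ∫ t in (0:ℝ)..1, ‖fderiv ℝ f ((1 - t) • x + t • y)‖ ^ 2 :=
      intervalIntegral.integral_nonneg (by norm_num) (fun t _ => by positivity)
    have h2 : ‖y - x‖ ^ 2 ≤ 4 * R ^ 2 := by
      have hx' : ‖x‖ ≤ R := by simpa [hB] using hx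
      have hy' : ‖y‖ ≤ R := by simpa [hB] using hy
      have := norm_sub_le y x
      nlinarith [norm_nonneg (y - x)]
    calc ENNReal.ofReal ((f y - f x) ^ 2)
        ≤ ENNReal.ofReal (4 * R ^ 2 * ∫ t in (0:ℝ)..1, ‖fderiv ℝ f ((1 - t) • x + t • y)‖ ^ 2) := by
          apply ENNReal.ofReal_le_ofReal
          have := mul_le_mul_of_nonneg_right h2 hint
          nlinarith
      _ = ENNReal.ofReal (4 * R ^ 2) * ∫⁻ t in Set.Ioc (0:ℝ) 1, G ((1 - t) • x + t • y) := by
          rw [ENNReal.ofReal_mul (by positivity), intervalIntegral.integral_of_le (by norm_num),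
            ofReal_integral_eq_lintegral_ofReal]
          · have : Continuous fun t : ℝ => ‖fderiv ℝ f ((1 - t) • x + t • y)‖ ^ 2 :=
              (hd.comp (by fun_prop)).norm.pow 2
            exact (this.integrableOn_Icc).mono_set Set.Ioc_subset_Icc_self
          · exact Filter.Eventually.of_forall fun t => by positivity
      _ = _ := by
          congr 1
          apply setLIntegral_congr_fun measurableSet_Ioc
          intro t ht
          have hmem : (1 - t) • x + t • y ∈ B :=
            (convex_closedBall (0:V3) R) hx hy (by linarith [ht.2]) ht.1.le (by ring)
          simp [hFdef, hmem]
  have hdbl : ∫⁻ x in B, ∫⁻ y in B, ENNReal.ofReal ((f y - f x) ^ 2) ≤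
      ENNReal.ofReal (32 * R ^ 2) * volume B * ∫⁻ x in B, G x := by
    calc ∫⁻ x in B, ∫⁻ y in B, ENNReal.ofReal ((f y - f x) ^ 2)
        ≤ ∫⁻ x in B, ∫⁻ y in B, ENNReal.ofReal (4 * R ^ 2) *
            ∫⁻ t in Set.Ioc (0:ℝ) 1, F ((1 - t) • x + t • y) := by
          apply setLIntegral_mono' hBm
          intro x hx
          apply setLIntegral_mono' hBm
          intro y hy
          exact hpt x hx y hy
      _ = ENNReal.ofReal (4 * R ^ 2) * ∫⁻ x in B, ∫⁻ y in B,
            ∫⁻ t in Set.Ioc (0:ℝ) 1, F ((1 - t) • x + t • y) := by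
          rw [← lintegral_const_mul' _ _ ENNReal.ofReal_ne_top]
          congr 1; ext x
          rw [← lintegral_const_mul' _ _ ENNReal.ofReal_ne_top]
      _ = ENNReal.ofReal (4 * R ^ 2) * ∫⁻ t in Set.Ioc (0:ℝ) 1, ∫⁻ x in B, ∫⁻ y in B,
            F ((1 - t) • x + t • y) := by
          congr 1
          have hsw : ∀ x : V3, ∫⁻ y in B, ∫⁻ t in Set.Ioc (0:ℝ) 1, F ((1 - t) • x + t • y) =
              ∫⁻ t in Set.Ioc (0:ℝ) 1, ∫⁻ y in B, F ((1 - t) • x + t • y) := fun x =>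
            lintegral_lintegral_swap (hF.comp (by fun_prop)).aemeasurable
          simp_rw [hsw]
          apply lintegral_lintegral_swap
          apply Measurable.aemeasurable
          have hm4 : Measurable fun p : (V3 × ℝ) × V3 => F ((1 - p.1.2) • p.1.1 + p.1.2 • p.2) :=
            hF.comp (by fun_prop)
          exact hm4.lintegral_prod_right'
      _ ≤ ENNReal.ofReal (4 * R ^ 2) * ∫⁻ t in Set.Ioc (0:ℝ) 1, 8 * volume B * ∫⁻ x, F x := by
          gcongr with t
          exact lint_double F hF B t
      _ = _ := by
          have h32 : ENNReal.ofReal (32 * R ^ 2) = ENNReal.ofReal (4 * R ^ 2) * ENNReal.ofReal 8 := by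
            rw [← ENNReal.ofReal_mul (by positivity)]; ring_nf
          rw [setLIntegral_const, hFint, h32]
          simp only [Real.volume_Ioc, sub_zero, ENNReal.ofReal_one, mul_one, ENNReal.ofReal_ofNat]
          ring
  have hvol0 : volume B ≠ 0 := (Metric.measure_closedBall_pos _ _ hR).ne'
  have hvolT : volume B ≠ ⊤ := (isCompact_closedBall _ _).measure_lt_top.ne
  have hcont : Measurable fun x => ∫⁻ y in B, ENNReal.ofReal ((f y - f x) ^ 2) := by
    have : Measurable fun p : V3 × V3 => ENNReal.ofReal ((f p.2 - f p.1) ^ 2) := by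
      apply Continuous.measurable
      exact ENNReal.continuous_ofReal.comp (by fun_prop)
    exact this.lintegral_prod_right'
  obtain ⟨x, _, hx⟩ := exists_le_setLAverage hvol0 hvolT hcont.aemeasurable
  refine ⟨f x, hx.trans ?_⟩
  rw [setLAverage_eq]
  apply ENNReal.div_le_of_le_mul
  calc _ ≤ _ := hdbl
    _ = _ := by ring

def pd (i : Fin 3) (u : V3 → ℝ) (v : V3) : ℝ := fderiv ℝ u v (EuclideanSpace.single i 1)

def bb (γ : ℝ) (i : Fin 3) (v : V3) : ℝ := v i * jap v ^ (γ - 2)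

def WW (γ : ℝ) (v : V3) : ℝ :=
  (1 / 4) * ‖v‖ ^ 2 * jap v ^ (2 * γ - 4) -
      ((3 / 2) * jap v ^ (γ - 2) + ((γ - 2) / 2) * ‖v‖ ^ 2 * jap v ^ (γ - 4))

lemma jap_sq (v : V3) : jap v ^ 2 = 1 + ‖v‖ ^ 2 := Real.sq_sqrt (by positivity)

lemma one_le_jap (v : V3) : 1 ≤ jap v := by
  rw [jap]; exact Real.one_le_sqrt.mpr (by nlinarith [sq_nonneg ‖v‖])

lemma jap_pos (v : V3) : 0 < jap v := lt_of_lt_of_le one_pos (one_le_jap v)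

lemma norm_le_jap (v : V3) : ‖v‖ ≤ jap v := by
  rw [jap]; exact Real.le_sqrt_of_sq_le (by linarith)

lemma jap_le (v : V3) : jap v ≤ 1 + ‖v‖ := by
  rw [jap]; exact Real.sqrt_le_iff.mpr ⟨by positivity, by nlinarith [norm_nonneg v]⟩

lemma jap_rpow (v : V3) (r : ℝ) : jap v ^ r = (1 + ‖v‖ ^ 2) ^ (r / 2) := by
  rw [jap, Real.sqrt_eq_rpow, ← Real.rpow_mul (by positivity)]; congr 1; ring

lemma contDiff_jap_rpow (r : ℝ) : ContDiff ℝ 1 (fun v : V3 => jap v ^ r) := by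
  simp_rw [jap_rpow]
  apply ContDiff.rpow_const_of_ne
  · exact contDiff_const.add (contDiff_norm_sq ℝ)
  · intro x; positivity

lemma cont_jap_rpow (r : ℝ) : Continuous (fun v : V3 => jap v ^ r) := (contDiff_jap_rpow r).continuous

lemma cont_jap : Continuous jap := by unfold jap; fun_prop

lemma pd_jap_rpow (i : Fin 3) (r : ℝ) (v : V3) :
    pd i (fun v : V3 => jap v ^ r) v = r * v i * jap v ^ (r - 2) := by
  have h1 : HasFDerivAt (fun v : V3 => 1 + ‖v‖ ^ 2) (2 • (innerSL ℝ v)) v :=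
    ((hasStrictFDerivAt_norm_sq v).hasFDerivAt).const_add 1
  have h2 := h1.rpow_const (p := r / 2) (Or.inl (by positivity))
  unfold pd
  simp_rw [jap_rpow]
  rw [h2.fderiv]
  simp [EuclideanSpace.inner_single_right]
  rw [show (r - 2) / 2 = r / 2 - 1 by ring]
  ring

lemma pd_mul (i : Fin 3) (u w : V3 → ℝ) (v : V3) (hu : DifferentiableAt ℝ u v)
    (hw : DifferentiableAt ℝ w v) :
    pd i (fun v => u v * w v) v = pd i u v * w v + u v * pd i w v := by
  unfold pd
  rw [fderiv_fun_mul hu hw]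
  simp; ring

lemma pd_coord (i j : Fin 3) (v : V3) : pd i (fun v : V3 => v j) v = if j = i then 1 else 0 := by
  unfold pd
  have : HasFDerivAt (fun v : V3 => v j) (EuclideanSpace.proj j : V3 →L[ℝ] ℝ) v :=
    (EuclideanSpace.proj j : V3 →L[ℝ] ℝ).hasFDerivAt
  rw [this.fderiv]
  simp

lemma contDiff_bb (γ : ℝ) (i : Fin 3) : ContDiff ℝ 1 (bb γ i) := by
  unfold bb
  exact (by fun_prop : ContDiff ℝ 1 fun v : V3 => v i).mul (contDiff_jap_rpow _)

lemma pd_bb (γ : ℝ) (i : Fin 3) (v : V3) :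
    pd i (bb γ i) v = jap v ^ (γ - 2) + (γ - 2) * v i ^ 2 * jap v ^ (γ - 4) := by
  unfold bb
  rw [pd_mul i _ _ v (by fun_prop) ((contDiff_jap_rpow _).differentiable (by norm_num) v), pd_coord,
    pd_jap_rpow]
  rw [show γ - 2 - 2 = γ - 4 by ring]
  simp; ring

lemma norm_fderiv_sq (u : V3 → ℝ) (v : V3) : ‖gradient u v‖ ^ 2 = ∑ i, pd i u v ^ 2 := by
  rw [EuclideanSpace.norm_sq_eq]
  apply Finset.sum_congr rfl
  intro i _
  have : (gradient u v) i = pd i u v := by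
    unfold pd gradient
    have h := InnerProductSpace.toDual_symm_apply (𝕜 := ℝ) (x := EuclideanSpace.single i (1:ℝ))
      (y := fderiv ℝ u v)
    rw [← h, EuclideanSpace.inner_single_right]
    simp
  rw [this, Real.norm_eq_abs, sq_abs]

lemma norm_fderiv_eq (u : V3 → ℝ) (v : V3) : ‖fderiv ℝ u v‖ ^ 2 = ∑ i, pd i u v ^ 2 := by
  rw [← norm_fderiv_sq]; unfold gradient; rw [LinearIsometryEquiv.norm_map]

lemma cont_pd {u : V3 → ℝ} (hu : ContDiff ℝ 1 u) (i : Fin 3) : Continuous (pd i u) := by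
  unfold pd
  exact (hu.continuous_fderiv (by norm_num)).clm_apply continuous_const

/-- temperate -/
def TG (F : V3 → ℝ) : Prop := Continuous F ∧ ∃ k : ℕ, ∃ C : ℝ, ∀ v, |F v| ≤ C * jap v ^ k

def RD (F : V3 → ℝ) : Prop := Continuous F ∧ ∀ k : ℕ, ∃ C : ℝ, ∀ v, jap v ^ k * |F v| ≤ C

lemma RD.mul {F G : V3 → ℝ} (hF : RD F) (hG : TG G) : RD (fun v => F v * G v) := by
  refine ⟨hF.1.mul hG.1, fun k => ?_⟩
  obtain ⟨l, D, hD⟩ := hG.2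
  obtain ⟨C, hC⟩ := hF.2 (k + l)
  have hD0 : 0 ≤ D := by
    have h := (abs_nonneg _).trans (hD 0)
    have := pow_pos (jap_pos 0) l
    exact nonneg_of_mul_nonneg_left h this
  refine ⟨C * D, fun v => ?_⟩
  rw [abs_mul]
  have hj := jap_pos v
  calc jap v ^ k * (|F v| * |G v|) ≤ jap v ^ k * (|F v| * (D * jap v ^ l)) := by
        gcongr; exact hD v
    _ = (jap v ^ (k + l) * |F v|) * D := by rw [pow_add]; ring
    _ ≤ C * D := by gcongr; exact hC v

lemma RD.tg {F : V3 → ℝ} (hF : RD F) : TG F := by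
  obtain ⟨C, hC⟩ := hF.2 0
  exact ⟨hF.1, 0, C, fun v => by simpa using hC v⟩

lemma RD.add {F G : V3 → ℝ} (hF : RD F) (hG : RD G) : RD (fun v => F v + G v) := by
  refine ⟨hF.1.add hG.1, fun k => ?_⟩
  obtain ⟨D, hD⟩ := hG.2 k
  obtain ⟨C, hC⟩ := hF.2 k
  refine ⟨C + D, fun v => ?_⟩
  have hj := pow_pos (jap_pos v) k
  calc jap v ^ k * |F v + G v| ≤ jap v ^ k * (|F v| + |G v|) := by gcongr; exact abs_add_le _ _
    _ ≤ _ := by linarith [hD v, hC v]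

lemma TG.mul {F G : V3 → ℝ} (hF : TG F) (hG : TG G) : TG (fun v => F v * G v) := by
  obtain ⟨l, D, hD⟩ := hG.2
  obtain ⟨k, C, hC⟩ := hF.2
  refine ⟨hF.1.mul hG.1, k + l, C * D, fun v => ?_⟩
  rw [abs_mul, pow_add]
  calc |F v| * |G v| ≤ (C * jap v ^ k) * (D * jap v ^ l) := by
        apply mul_le_mul (hC v) (hD v) (abs_nonneg _) ((abs_nonneg _).trans (hC v))
    _ = _ := by ring

lemma TG.add {F G : V3 → ℝ} (hF : TG F) (hG : TG G) : TG (fun v => F v + G v) := by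
  obtain ⟨l, D, hD⟩ := hG.2
  obtain ⟨k, C, hC⟩ := hF.2
  refine ⟨hF.1.add hG.1, k + l, |C| + |D|, fun v => ?_⟩
  have hj := one_le_jap v
  calc |F v + G v| ≤ |F v| + |G v| := abs_add_le _ _
    _ ≤ C * jap v ^ k + D * jap v ^ l := add_le_add (hC v) (hD v)
    _ ≤ |C| * jap v ^ (k + l) + |D| * jap v ^ (k + l) := by
        gcongr
        · exact le_abs_self C
        · omega
        · exact le_abs_self D
        · omega
    _ = _ := by ring

lemma tg_const (c : ℝ) : TG (fun _ => c) := ⟨continuous_const, 0, |c|, fun v => by simp⟩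

lemma tg_jap (r : ℝ) : TG (fun v => jap v ^ r) := by
  refine ⟨cont_jap_rpow r, ⌈r⌉₊, 1, fun v => ?_⟩
  rw [abs_of_nonneg (Real.rpow_nonneg (jap_pos v).le r), one_mul, ← Real.rpow_natCast]
  exact Real.rpow_le_rpow_of_exponent_le (one_le_jap v) (Nat.le_ceil r)

lemma tg_coord (i : Fin 3) : TG (fun v => v i) := by
  refine ⟨by fun_prop, 1, 1, fun v => ?_⟩
  have := PiLp.norm_apply_le v i
  rw [Real.norm_eq_abs] at this
  simpa using this.trans (norm_le_jap v)

lemma tg_norm : TG (fun v => ‖v‖) := by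
  refine ⟨by fun_prop, 1, 1, fun v => ?_⟩
  simpa using norm_le_jap v

lemma RD.integrable {F : V3 → ℝ} (hF : RD F) : Integrable F := by
  obtain ⟨C, hC⟩ := hF.2 4
  have h0 : Integrable (fun v : V3 => ((1 : ℝ) + ‖v‖ ^ 2) ^ (-(4:ℝ) / 2)) :=
    integrable_rpow_neg_one_add_norm_sq (by simp; norm_num)
  refine (h0.const_mul C).mono' hF.1.aestronglyMeasurable (Filter.Eventually.of_forall fun v => ?_)
  rw [← jap_rpow, Real.rpow_neg (jap_pos v).le, Real.norm_eq_abs, ← div_eq_mul_inv,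
    le_div_iff₀ (Real.rpow_pos_of_pos (jap_pos v) _)]
  have := hC v
  rw [show (4:ℝ) = ((4:ℕ):ℝ) by norm_num, Real.rpow_natCast]
  linarith

lemma tg_bb (γ : ℝ) (i : Fin 3) : TG (bb γ i) := (tg_coord i).mul (tg_jap _)

lemma tg_pd_bb (γ : ℝ) (i : Fin 3) : TG (pd i (bb γ i)) := by
  have : pd i (bb γ i) = fun v => jap v ^ (γ - 2) + ((γ - 2) * (v i * v i)) * jap v ^ (γ - 4) := by
    funext v; rw [pd_bb]; ring
  rw [this]
  exact (tg_jap _).add (((tg_const _).mul ((tg_coord i).mul (tg_coord i))).mul (tg_jap _))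

lemma tg_WW (γ : ℝ) : TG (WW γ) := by
  have : WW γ = fun v => ((1 / 4) * (‖v‖ * ‖v‖)) * jap v ^ (2 * γ - 4) +
      ((-(3 / 2)) * jap v ^ (γ - 2) + (-((γ - 2) / 2)) * ((‖v‖ * ‖v‖) * jap v ^ (γ - 4))) := by
    funext v; unfold WW; ring
  rw [this]
  exact (((tg_const _).mul (tg_norm.mul tg_norm)).mul (tg_jap _)).add
    (((tg_const _).mul (tg_jap _)).add ((tg_const _).mul ((tg_norm.mul tg_norm).mul (tg_jap _))))

structure Nice (u : V3 → ℝ) : Prop where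
  cd : ContDiff ℝ 1 u
  rd : RD u
  rd' : ∀ i, RD (pd i u)

lemma Nice.diff {u : V3 → ℝ} (hu : Nice u) : Differentiable ℝ u := hu.cd.differentiable (by norm_num)

lemma pd_lin (i : Fin 3) {u w : V3 → ℝ} (hu : Differentiable ℝ u) (hw : Differentiable ℝ w) (c : ℝ)
    (v : V3) : pd i (fun v => u v - c * w v) v = pd i u v - c * pd i w v := by
  unfold pd
  rw [fderiv_fun_sub (hu v) ((hw v).const_mul c), fderiv_const_mul (hw v)]
  simp

lemma RD.cmul {F : V3 → ℝ} (hF : RD F) (c : ℝ) : RD (fun v => c * F v) := by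
  have := hF.mul (tg_const c)
  simpa [mul_comm] using this

lemma RD.lin {u w : V3 → ℝ} (hu : RD u) (hw : RD w) (c : ℝ) : RD (fun v => u v - c * w v) := by
  have := hu.add (hw.cmul (-c))
  convert this using 2
  ring

lemma Nice.lin {u w : V3 → ℝ} (hu : Nice u) (hw : Nice w) (c : ℝ) :
    Nice (fun v => u v - c * w v) := by
  refine ⟨hu.cd.sub (contDiff_const.mul hw.cd), hu.rd.lin hw.rd c, fun i => ?_⟩
  have : pd i (fun v => u v - c * w v) = fun v => pd i u v - c * pd i w v := by
    funext v; exact pd_lin i hu.diff hw.diff c v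
  rw [this]
  exact (hu.rd' i).lin (hw.rd' i) c

lemma rd_schwartz (g : SchwartzMap V3 ℝ) : RD (fun v => g v) := by
  refine ⟨g.continuous, fun k => ?_⟩
  refine ⟨_, fun v => le_trans ?_
    (SchwartzMap.one_add_le_sup_seminorm_apply (𝕜 := ℝ) (m := (k, 0)) (le_refl k) (le_refl 0) g v)⟩
  rw [norm_iteratedFDeriv_zero, Real.norm_eq_abs]
  gcongr
  · exact (jap_pos v).le
  · exact jap_le v

def sd (i : Fin 3) (g : SchwartzMap V3 ℝ) : SchwartzMap V3 ℝ :=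
  SchwartzMap.evalCLM ℝ V3 ℝ (EuclideanSpace.single i 1) (SchwartzMap.fderivCLM ℝ V3 ℝ g)

lemma sd_eq (i : Fin 3) (g : SchwartzMap V3 ℝ) : (fun v => sd i g v) = pd i (fun v => g v) := rfl

lemma nice_schwartz (g : SchwartzMap V3 ℝ) : Nice (fun v => g v) :=
  ⟨g.smooth 1, rd_schwartz g, fun i => by rw [← sd_eq]; exact rd_schwartz _⟩

lemma sqrtM_cd (γ Φ0 : ℝ) : ContDiff ℝ 1 (sqrtM γ Φ0) := by
  unfold sqrtM Phi
  exact ((((contDiff_const.mul (contDiff_jap_rpow γ)).add contDiff_const).neg).div_const 2).exp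

lemma pd_Phi (γ Φ0 : ℝ) (hγ : 0 < γ) (i : Fin 3) (v : V3) : pd i (Phi γ Φ0) v = bb γ i v := by
  have h := pd_jap_rpow i γ v
  have hd : DifferentiableAt ℝ (fun v : V3 => jap v ^ γ) v :=
    (contDiff_jap_rpow γ).differentiable (by norm_num) v
  unfold pd Phi at *
  rw [fderiv_add_const, fderiv_const_mul hd]
  simp only [_root_.smul_apply, h, bb, smul_eq_mul]
  field_simp

lemma Phi_diff (γ Φ0 : ℝ) : Differentiable ℝ (Phi γ Φ0) := by
  unfold Phi
  exact (((contDiff_jap_rpow γ).differentiable (by norm_num)).const_mul _).add_const _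

lemma pd_expPhi (γ Φ0 : ℝ) (hγ : 0 < γ) (s : ℝ) (i : Fin 3) (v : V3) :
    pd i (fun v => Real.exp (s * Phi γ Φ0 v)) v = s * bb γ i v * Real.exp (s * Phi γ Φ0 v) := by
  have h := pd_Phi γ Φ0 hγ i v
  have hd := (((Phi_diff γ Φ0 v).hasFDerivAt).const_mul s).exp
  unfold pd at *
  rw [hd.fderiv]
  simp [h]; ring

lemma sqrtM_eq (γ Φ0 : ℝ) : sqrtM γ Φ0 = fun v => Real.exp ((-1/2) * Phi γ Φ0 v) := by
  funext v; unfold sqrtM; congr 1; ring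

lemma pd_sqrtM (γ Φ0 : ℝ) (hγ : 0 < γ) (i : Fin 3) (v : V3) :
    pd i (sqrtM γ Φ0) v = sqrtM γ Φ0 v * ((-1/2) * bb γ i v) := by
  rw [sqrtM_eq, pd_expPhi γ Φ0 hγ]; ring

lemma rd_sqrtM (γ Φ0 : ℝ) (hγ : 0 < γ) : RD (sqrtM γ Φ0) := by
  refine ⟨(sqrtM_cd γ Φ0).continuous, fun k => ?_⟩
  set n := ⌈(k:ℝ) / γ⌉₊ with hn
  refine ⟨Real.exp (-Φ0/2) * (n.factorial * (2 * γ) ^ n), fun v => ?_⟩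
  have hj := jap_pos v
  have hjg : 0 < jap v ^ γ := Real.rpow_pos_of_pos hj _
  have hy : 0 ≤ jap v ^ γ / (2 * γ) := by positivity
  have h1 := Real.pow_div_factorial_le_exp _ hy n
  have h2 : sqrtM γ Φ0 v = Real.exp (-Φ0/2) * (Real.exp (jap v ^ γ / (2 * γ)))⁻¹ := by
    rw [← Real.exp_neg, ← Real.exp_add]; unfold sqrtM Phi; congr 1; field_simp; ring
  have h3 : jap v ^ k ≤ (jap v ^ γ) ^ n := by
    rw [← Real.rpow_natCast, ← Real.rpow_natCast, ← Real.rpow_mul hj.le]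
    apply Real.rpow_le_rpow_of_exponent_le (one_le_jap v)
    have := Nat.le_ceil ((k:ℝ) / γ)
    rw [div_le_iff₀ hγ] at this
    rw [mul_comm]; exact this
  rw [abs_of_pos (by unfold sqrtM; positivity), h2]
  have h4 : jap v ^ k * (Real.exp (jap v ^ γ / (2 * γ)))⁻¹ ≤ n.factorial * (2 * γ) ^ n := by
    rw [← div_eq_mul_inv, div_le_iff₀ (Real.exp_pos _)]
    calc jap v ^ k ≤ (jap v ^ γ) ^ n := h3
      _ = n.factorial * (2 * γ) ^ n * ((jap v ^ γ / (2 * γ)) ^ n / n.factorial) := by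
          rw [div_pow]; field_simp
      _ ≤ _ := by gcongr
  have := mul_le_mul_of_nonneg_left h4 (Real.exp_pos (-Φ0/2)).le
  linarith

lemma nice_sqrtM (γ Φ0 : ℝ) (hγ : 0 < γ) : Nice (sqrtM γ Φ0) := by
  refine ⟨sqrtM_cd γ Φ0, rd_sqrtM γ Φ0 hγ, fun i => ?_⟩
  have : pd i (sqrtM γ Φ0) = fun v => sqrtM γ Φ0 v * ((-1/2) * bb γ i v) := by
    funext v; exact pd_sqrtM γ Φ0 hγ i v
  rw [this]
  exact (rd_sqrtM γ Φ0 hγ).mul ((tg_const _).mul (tg_bb γ i))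

def EE (γ : ℝ) (u : V3 → ℝ) : ℝ := ∫ v, ∑ i, (pd i u v + 1 / 2 * u v * bb γ i v) ^ 2

lemma ibp (i : Fin 3) {u w : V3 → ℝ} (hu : Differentiable ℝ u) (hw : Differentiable ℝ w)
    (h1 : RD (fun v => pd i u v * w v)) (h2 : RD (fun v => u v * pd i w v))
    (h3 : RD (fun v => u v * w v)) :
    ∫ v, u v * pd i w v = -∫ v, pd i u v * w v :=
  integral_mul_fderiv_eq_neg_fderiv_mul_of_integrable h1.integrable h2.integrable h3.integrable
    (fun x _ => hu x) (fun x _ => hw x)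

lemma cross (γ : ℝ) (i : Fin 3) {u : V3 → ℝ} (hu : Nice u) :
    ∫ v, u v * (pd i u v * bb γ i v) = -(1/2) * ∫ v, u v * (u v * pd i (bb γ i) v) := by
  have hb : Differentiable ℝ (bb γ i) := (contDiff_bb γ i).differentiable (by norm_num)
  have hp : pd i (fun v => u v * bb γ i v) =
      fun v => pd i u v * bb γ i v + u v * pd i (bb γ i) v := by
    funext v; exact pd_mul i _ _ v (hu.diff v) (hb v)
  have r1 : RD (fun v => pd i u v * (u v * bb γ i v)) := (hu.rd' i).mul (hu.rd.tg.mul (tg_bb γ i))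
  have r2a : RD (fun v => u v * (pd i u v * bb γ i v)) := hu.rd.mul ((hu.rd' i).tg.mul (tg_bb γ i))
  have r2b : RD (fun v => u v * (u v * pd i (bb γ i) v)) :=
    hu.rd.mul (hu.rd.tg.mul (tg_pd_bb γ i))
  have h := ibp i (w := fun v => u v * bb γ i v) hu.diff (hu.diff.mul hb) r1
    (by rw [hp]; simpa only [mul_add] using r2a.add r2b) (hu.rd.mul (hu.rd.tg.mul (tg_bb γ i)))
  rw [hp] at h
  simp only [mul_add] at h
  rw [integral_add r2a.integrable r2b.integrable] at h
  have e : ∫ v, pd i u v * (u v * bb γ i v) = ∫ v, u v * (pd i u v * bb γ i v) := by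
    congr 1; funext v; ring
  rw [e] at h
  linarith

lemma rd_sq {u : V3 → ℝ} (hu : RD u) : RD (fun v => u v ^ 2) := by
  simpa only [sq] using hu.mul hu.tg

lemma rd_sum {F : Fin 3 → V3 → ℝ} (h : ∀ i, RD (F i)) : RD (fun v => ∑ i, F i v) := by
  simp only [Fin.sum_univ_three]
  exact ((h 0).add (h 1)).add (h 2)

lemma bb_sq (γ : ℝ) (v : V3) : ∑ i, bb γ i v ^ 2 = ‖v‖ ^ 2 * jap v ^ (2 * γ - 4) := by
  rw [EuclideanSpace.norm_sq_eq, Finset.sum_mul]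
  apply Finset.sum_congr rfl
  intro i _
  unfold bb
  rw [mul_pow, Real.norm_eq_abs, sq_abs, ← Real.rpow_natCast (jap v ^ (γ - 2)),
    ← Real.rpow_mul (jap_pos v).le]
  congr 2; push_cast; ring

lemma div_bb (γ : ℝ) (v : V3) :
    ∑ i, pd i (bb γ i) v = 3 * jap v ^ (γ - 2) + (γ - 2) * ‖v‖ ^ 2 * jap v ^ (γ - 4) := by
  rw [EuclideanSpace.norm_sq_eq]
  simp only [pd_bb, Fin.sum_univ_three, Real.norm_eq_abs, sq_abs]
  ring

lemma EE_eq (γ : ℝ) {u : V3 → ℝ} (hu : Nice u) :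
    EE γ u = (∫ v, ∑ i, pd i u v ^ 2) + ∫ v, WW γ v * u v ^ 2 := by
  have hb := tg_bb γ
  have hc := fun i => cross γ i hu
  have rA : ∀ i, RD (fun v => pd i u v ^ 2) := fun i => rd_sq (hu.rd' i)
  have rB : ∀ i, RD (fun v => u v * (pd i u v * bb γ i v)) := fun i =>
    hu.rd.mul ((hu.rd' i).tg.mul (hb i))
  have rC : ∀ i, RD (fun v => u v * (u v * pd i (bb γ i) v)) := fun i =>
    hu.rd.mul (hu.rd.tg.mul (tg_pd_bb γ i))
  have rD : RD (fun v => WW γ v * u v ^ 2) := by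
    simpa only [mul_comm] using (rd_sq hu.rd).mul (tg_WW γ)
  have rBs := rd_sum rB
  have rCs := rd_sum rC
  have rAs := rd_sum rA
  have key : ∀ v, ∑ i, (pd i u v + 1 / 2 * u v * bb γ i v) ^ 2 =
      (∑ i, pd i u v ^ 2 + WW γ v * u v ^ 2) + (∑ i, u v * (pd i u v * bb γ i v) +
        (1/2) * ∑ i, u v * (u v * pd i (bb γ i) v)) := by
    intro v
    have h1 := bb_sq γ v
    have h2 := div_bb γ v
    have h3 : WW γ v = (1/4) * ∑ i, bb γ i v ^ 2 - (1/2) * ∑ i, pd i (bb γ i) v := by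
      rw [h1, h2]; unfold WW; ring
    rw [h3]
    simp only [Fin.sum_univ_three]
    ring
  unfold EE
  simp_rw [key]
  rw [integral_add (rAs.add rD).integrable (rBs.add (rCs.cmul _)).integrable,
    integral_add rAs.integrable rD.integrable, integral_add rBs.integrable (rCs.cmul _).integrable,
    integral_const_mul, integral_finsetSum _ (fun i _ => (rB i).integrable),
    integral_finsetSum _ (fun i _ => (rC i).integrable)]
  simp_rw [hc]
  rw [← Finset.mul_sum]
  ring

lemma L_eq (γ : ℝ) (g : SchwartzMap V3 ℝ) :
    -(∫ v : V3, Lop γ (fun w => g w) v * g v) = EE γ (fun v => g v) := by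
  have hu := nice_schwartz g
  have hu' := fun i => nice_schwartz (sd i g)
  rw [EE_eq γ hu]
  set u : V3 → ℝ := fun v => g v with hudef
  have hi : ∀ i, ∫ v, u v * pd i (pd i u) v = -∫ v, pd i u v ^ 2 := by
    intro i
    have h2 : Nice (pd i u) := hu' i
    rw [ibp i hu.diff h2.diff (h2.rd.mul h2.rd.tg) (hu.rd.mul (h2.rd' i).tg) (hu.rd.mul h2.rd.tg)]
    simp only [sq]
  have rB : ∀ i, RD (fun v => u v * pd i (pd i u) v) := fun i => by
    have h2 : Nice (pd i u) := hu' i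
    exact hu.rd.mul (h2.rd' i).tg
  have rA : ∀ i, RD (fun v => pd i u v ^ 2) := fun i => rd_sq (hu.rd' i)
  have rD : RD (fun v => WW γ v * u v ^ 2) := by
    simpa only [mul_comm] using (rd_sq hu.rd).mul (tg_WW γ)
  have key : ∀ v, Lop γ u v * u v = (∑ i, u v * pd i (pd i u) v) - 1 * (WW γ v * u v ^ 2) := by
    intro v
    have : lap u v = ∑ i, pd i (pd i u) v := rfl
    unfold Lop WW
    rw [this, ← Finset.mul_sum]
    ring
  change -(∫ v : V3, Lop γ u v * u v) = _
  simp_rw [key]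
  rw [integral_sub (rd_sum rB).integrable (rD.cmul 1).integrable, integral_const_mul,
    integral_finsetSum _ (fun i _ => (rB i).integrable),
    integral_finsetSum _ (fun i _ => (rA i).integrable)]
  simp_rw [hi]
  rw [Finset.sum_neg_distrib]
  ring

lemma WW_lower (γ : ℝ) (hγ : 0 < γ) : ∃ R : ℝ, 0 < R ∧ ∃ C : ℝ, 0 ≤ C ∧ ∀ v : V3,
    (1/8) * jap v ^ (2 * (γ - 1)) - C * (Metric.closedBall (0:V3) R).indicator 1 v ≤ WW γ v := by
  set A := 3/2 + |γ - 2| / 2 with hA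
  have hA0 : 0 < A := by positivity
  set R := max 2 ((16 * A) ^ (1 / γ)) with hR
  have hR2 : 2 ≤ R := le_max_left _ _
  have hR0 : 0 < R := by linarith
  have hcont : Continuous (fun v => (1/8) * jap v ^ (2 * (γ - 1)) - WW γ v) :=
    (continuous_const.mul (cont_jap_rpow _)).sub (tg_WW γ).1
  obtain ⟨C, hC⟩ := (isCompact_closedBall (0:V3) R).exists_bound_of_continuousOn hcont.continuousOn
  refine ⟨R, hR0, |C|, abs_nonneg _, fun v => ?_⟩
  by_cases hv : v ∈ Metric.closedBall (0:V3) R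
  · rw [Set.indicator_of_mem hv]
    have := (le_abs_self _).trans (hC v hv)
    simp only [Pi.one_apply, mul_one]
    linarith [le_abs_self C]
  · rw [Set.indicator_of_notMem hv]
    have hvR : R < ‖v‖ := by simpa using hv
    have hj := jap_pos v
    have hjR : R ≤ jap v := hvR.le.trans (norm_le_jap v)
    set X := jap v ^ (2 * (γ - 1)) with hX
    have hX0 : 0 < X := Real.rpow_pos_of_pos hj _
    have e1 : jap v ^ (2 * γ - 4) * jap v ^ 2 = X := by
      rw [← Real.rpow_natCast, ← Real.rpow_add hj]; congr 1; push_cast; ring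
    have e2 : jap v ^ (γ - 2) * jap v ^ γ = X := by
      rw [← Real.rpow_add hj]; congr 1; ring
    have e3 : jap v ^ (γ - 4) * jap v ^ 2 = jap v ^ (γ - 2) := by
      rw [← Real.rpow_natCast, ← Real.rpow_add hj]; congr 1; push_cast; ring
    have hg : 16 * A ≤ jap v ^ γ := by
      calc 16 * A = ((16 * A) ^ (1 / γ)) ^ γ := by
            rw [← Real.rpow_mul (by positivity), one_div, inv_mul_cancel₀ hγ.ne', Real.rpow_one]
        _ ≤ jap v ^ γ := by
            apply Real.rpow_le_rpow (by positivity) _ hγ.le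
            exact (le_max_right _ _).trans hjR
    have p1 : 0 < jap v ^ (2 * γ - 4) := Real.rpow_pos_of_pos hj _
    have p2 : 0 < jap v ^ (γ - 2) := Real.rpow_pos_of_pos hj _
    have p3 : 0 < jap v ^ (γ - 4) := Real.rpow_pos_of_pos hj _
    have hn : ‖v‖ ^ 2 = jap v ^ 2 - 1 := by rw [jap_sq]; ring
    have hj4 : 4 ≤ jap v ^ 2 := by nlinarith
    have q1 : 4 * jap v ^ (2 * γ - 4) ≤ X := by rw [← e1]; nlinarith
    have q2 : 16 * A * jap v ^ (γ - 2) ≤ X := by rw [← e2]; nlinarith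
    have q3 : ‖v‖ ^ 2 * jap v ^ (γ - 4) ≤ jap v ^ (γ - 2) := by rw [← e3, hn]; nlinarith
    have q3' : 0 ≤ ‖v‖ ^ 2 * jap v ^ (γ - 4) := by positivity
    have q4 : (γ - 2) / 2 * (‖v‖ ^ 2 * jap v ^ (γ - 4)) ≤ |γ - 2| / 2 * jap v ^ (γ - 2) := by
      apply mul_le_mul _ q3 q3' (by positivity)
      linarith [le_abs_self (γ - 2)]
    have q5 : ‖v‖ ^ 2 * jap v ^ (2 * γ - 4) = X - jap v ^ (2 * γ - 4) := by
      rw [hn, ← e1]; ring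
    unfold WW
    have q6 : A * jap v ^ (γ - 2) = 3/2 * jap v ^ (γ - 2) + |γ - 2| / 2 * jap v ^ (γ - 2) := by
      rw [hA]; ring
    nlinarith

lemma EE_shift (γ Φ0 : ℝ) (hγ : 0 < γ) {g : V3 → ℝ} (hg : Nice g) (c : ℝ) :
    EE γ (fun v => g v - c * sqrtM γ Φ0 v) = EE γ g := by
  unfold EE
  congr 1; funext v
  apply Finset.sum_congr rfl
  intro i _
  rw [pd_lin i hg.diff (nice_sqrtM γ Φ0 hγ).diff, pd_sqrtM γ Φ0 hγ]
  ring

lemma rd_EE (γ : ℝ) {u : V3 → ℝ} (hu : Nice u) :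
    RD (fun v => ∑ i, (pd i u v + 1 / 2 * u v * bb γ i v) ^ 2) := by
  apply rd_sum
  intro i
  exact rd_sq ((hu.rd' i).add ((hu.rd.cmul (1/2)).mul (tg_bb γ i)))

lemma local_est (γ Φ0 : ℝ) (hγ : 0 < γ) (R : ℝ) (hR : 0 < R) : ∃ K : ℝ, 0 ≤ K ∧
    ∀ g : V3 → ℝ, Nice g → ∃ c : ℝ,
      ∫ v in Metric.closedBall (0:V3) R, (g v - c * sqrtM γ Φ0 v) ^ 2 ≤ K * EE γ g := by
  set B := Metric.closedBall (0:V3) R with hB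
  have hBm : MeasurableSet B := Metric.isClosed_closedBall.measurableSet
  have hm := nice_sqrtM γ Φ0 hγ
  set q : V3 → ℝ := fun v => Real.exp ((1/2) * Phi γ Φ0 v) with hq
  have hqcd : ContDiff ℝ 1 q := by
    unfold q Phi
    exact (contDiff_const.mul ((contDiff_const.mul (contDiff_jap_rpow γ)).add contDiff_const)).exp
  have hqd : Differentiable ℝ q := hqcd.differentiable (by norm_num)
  have hmq : ∀ v, sqrtM γ Φ0 v * q v = 1 := by
    intro v; unfold sqrtM; rw [hq, ← Real.exp_add]; simp; ring
  obtain ⟨C1, hC1⟩ := (isCompact_closedBall (0:V3) R).exists_bound_of_continuousOn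
    (hm.rd.1.pow 2).continuousOn
  obtain ⟨C2, hC2⟩ := (isCompact_closedBall (0:V3) R).exists_bound_of_continuousOn
    (hqcd.continuous.pow 2).continuousOn
  refine ⟨|C1| * (32 * R ^ 2) * |C2|, by positivity, fun g hg => ?_⟩
  set f : V3 → ℝ := fun v => g v * q v with hf
  have hfcd : ContDiff ℝ 1 f := hg.cd.mul hqcd
  obtain ⟨c, hc⟩ := poinc R hR f hfcd
  refine ⟨c, ?_⟩
  have hu := hg.lin hm c
  set e : V3 → ℝ := fun v => ∑ i, (pd i g v + 1 / 2 * g v * bb γ i v) ^ 2 with he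
  have he0 : ∀ v, 0 ≤ e v := fun v => Finset.sum_nonneg fun i _ => sq_nonneg _
  have hfd : ∀ v, ‖fderiv ℝ f v‖ ^ 2 = q v ^ 2 * e v := by
    intro v
    rw [norm_fderiv_eq, he, Finset.mul_sum]
    apply Finset.sum_congr rfl
    intro i _
    have h1 : pd i q v = 1/2 * bb γ i v * q v := pd_expPhi γ Φ0 hγ (1/2) i v
    rw [hf, pd_mul i _ _ v (hg.diff v) (hqd v), h1]
    ring
  have hEE : EE γ g = ∫ v, e v := rfl
  have hEE0 : 0 ≤ EE γ g := integral_nonneg he0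
  rw [← ENNReal.ofReal_le_ofReal_iff (by positivity),
    ofReal_integral_eq_lintegral_ofReal (rd_sq hu.rd).integrable.integrableOn
      (Filter.Eventually.of_forall fun v => sq_nonneg _)]
  calc ∫⁻ v in B, ENNReal.ofReal ((g v - c * sqrtM γ Φ0 v) ^ 2)
      ≤ ∫⁻ v in B, ENNReal.ofReal |C1| * ENNReal.ofReal ((f v - c) ^ 2) := by
        apply setLIntegral_mono' hBm
        intro v hv
        rw [← ENNReal.ofReal_mul (abs_nonneg _)]
        apply ENNReal.ofReal_le_ofReal
        have h1 : g v - c * sqrtM γ Φ0 v = sqrtM γ Φ0 v * (f v - c) := by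
          have := hmq v
          simp only [hf]
          linear_combination (-(g v)) * this
        rw [h1, mul_pow]
        gcongr
        exact (le_abs_self _).trans ((hC1 v hv).trans (le_abs_self _))
    _ = ENNReal.ofReal |C1| * ∫⁻ v in B, ENNReal.ofReal ((f v - c) ^ 2) := by
        rw [lintegral_const_mul' _ _ ENNReal.ofReal_ne_top]
    _ ≤ ENNReal.ofReal |C1| * (ENNReal.ofReal (32 * R ^ 2) *
          ∫⁻ v in B, ENNReal.ofReal (‖fderiv ℝ f v‖ ^ 2)) := by gcongr
    _ ≤ ENNReal.ofReal |C1| * (ENNReal.ofReal (32 * R ^ 2) *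
          ∫⁻ v in B, ENNReal.ofReal |C2| * ENNReal.ofReal (e v)) := by
        gcongr 2
        apply setLIntegral_mono' hBm
        intro v hv
        rw [hfd, ← ENNReal.ofReal_mul (abs_nonneg _)]
        apply ENNReal.ofReal_le_ofReal
        apply mul_le_mul_of_nonneg_right _ (he0 v)
        exact (le_abs_self _).trans ((hC2 v hv).trans (le_abs_self _))
    _ = ENNReal.ofReal |C1| * (ENNReal.ofReal (32 * R ^ 2) *
          (ENNReal.ofReal |C2| * ∫⁻ v in B, ENNReal.ofReal (e v))) := by
        rw [lintegral_const_mul' _ _ ENNReal.ofReal_ne_top]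
    _ ≤ ENNReal.ofReal |C1| * (ENNReal.ofReal (32 * R ^ 2) *
          (ENNReal.ofReal |C2| * ∫⁻ v, ENNReal.ofReal (e v))) := by
        gcongr
        exact Measure.restrict_le_self
    _ = _ := by
        have hI : ENNReal.ofReal (EE γ g) = ∫⁻ v, ENNReal.ofReal (e v) := by
          rw [hEE]
          exact ofReal_integral_eq_lintegral_ofReal
            (rd_EE γ hg).integrable (Filter.Eventually.of_forall he0)
        rw [← hI, ← ENNReal.ofReal_mul (by positivity), ← ENNReal.ofReal_mul (by positivity),
          ← ENNReal.ofReal_mul (by positivity)]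
        congr 1; ring

def SS (γ : ℝ) (u : V3 → ℝ) : ℝ :=
  (∫ v : V3, jap v ^ (2 * (γ - 1)) * u v ^ 2) + ∫ v : V3, ∑ i, pd i u v ^ 2

lemma rd_w (r : ℝ) {u : V3 → ℝ} (hu : RD u) : RD (fun v => jap v ^ r * u v ^ 2) := by
  simpa only [mul_comm] using (rd_sq hu).mul (tg_jap r)

lemma rd_g {u : V3 → ℝ} (hu : Nice u) : RD (fun v => ∑ i, pd i u v ^ 2) :=
  rd_sum fun i => rd_sq (hu.rd' i)

lemma w_nonneg (r : ℝ) (u : V3 → ℝ) : 0 ≤ ∫ v, jap v ^ r * u v ^ 2 :=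
  integral_nonneg fun v => mul_nonneg (Real.rpow_nonneg (jap_pos v).le _) (sq_nonneg _)

lemma g_nonneg (u : V3 → ℝ) : 0 ≤ ∫ v, ∑ i, pd i u v ^ 2 :=
  integral_nonneg fun _ => Finset.sum_nonneg fun _ _ => sq_nonneg _

lemma SS_lin (γ : ℝ) {u w : V3 → ℝ} (hu : Nice u) (hw : Nice w) (d : ℝ) :
    SS γ (fun v => u v - d * w v) ≤ 2 * SS γ u + 2 * d ^ 2 * SS γ w := by
  have hl := hu.lin hw d
  have h1 : ∫ v, jap v ^ (2 * (γ - 1)) * (u v - d * w v) ^ 2 ≤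
      2 * (∫ v, jap v ^ (2 * (γ - 1)) * u v ^ 2) +
        2 * d ^ 2 * ∫ v, jap v ^ (2 * (γ - 1)) * w v ^ 2 := by
    rw [← integral_const_mul, ← integral_const_mul, ← integral_add
      ((rd_w _ hu.rd).cmul _).integrable ((rd_w _ hw.rd).cmul _).integrable]
    apply integral_mono (rd_w _ hl.rd).integrable
      (((rd_w _ hu.rd).cmul _).add ((rd_w _ hw.rd).cmul _)).integrable
    intro v
    have := Real.rpow_nonneg (jap_pos v).le (2 * (γ - 1))
    have h : (u v - d * w v) ^ 2 ≤ 2 * u v ^ 2 + 2 * d ^ 2 * w v ^ 2 := by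
      nlinarith [sq_nonneg (u v + d * w v)]
    have := mul_le_mul_of_nonneg_left h this
    simp only
    linarith
  have h2 : ∫ v, ∑ i, pd i (fun v => u v - d * w v) v ^ 2 ≤
      2 * (∫ v, ∑ i, pd i u v ^ 2) + 2 * d ^ 2 * ∫ v, ∑ i, pd i w v ^ 2 := by
    rw [← integral_const_mul, ← integral_const_mul, ← integral_add
      ((rd_g hu).cmul _).integrable ((rd_g hw).cmul _).integrable]
    apply integral_mono (rd_g hl).integrable
      (((rd_g hu).cmul _).add ((rd_g hw).cmul _)).integrable
    intro v
    simp only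
    rw [Finset.mul_sum, Finset.mul_sum, ← Finset.sum_add_distrib]
    apply Finset.sum_le_sum
    intro i _
    rw [pd_lin i hu.diff hw.diff]
    nlinarith [sq_nonneg (pd i u v + d * pd i w v)]
  unfold SS
  linarith

lemma cs (γ : ℝ) {u w : V3 → ℝ} (hu : RD u) (hw : RD w) :
    (∫ v, u v * w v) ^ 2 ≤ ((∫ v, jap v ^ (-(2 * (γ - 1))) * w v ^ 2) + 1) *
      ∫ v, jap v ^ (2 * (γ - 1)) * u v ^ 2 := by
  have hN0 : 0 ≤ ∫ v, jap v ^ (-(2 * (γ - 1))) * w v ^ 2 := w_nonneg _ _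
  obtain ⟨d, hd⟩ : ∃ d, d = ∫ v, u v * w v := ⟨_, rfl⟩
  obtain ⟨N, hN⟩ : ∃ N, N = ∫ v, jap v ^ (-(2 * (γ - 1))) * w v ^ 2 := ⟨_, rfl⟩
  obtain ⟨A, hA⟩ : ∃ A, A = ∫ v, jap v ^ (2 * (γ - 1)) * u v ^ 2 := ⟨_, rfl⟩
  rw [← hN] at hN0
  rw [← hd, ← hN, ← hA]
  have h : 2 * d * d ≤ (N + 1) * A + d ^ 2 / (N + 1) * N := by
    have e1 : 2 * d * d = ∫ v, 2 * d * (u v * w v) := by rw [integral_const_mul, ← hd]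
    have e2 : (N + 1) * A = ∫ v, (N + 1) * (jap v ^ (2 * (γ - 1)) * u v ^ 2) := by
      rw [integral_const_mul, ← hA]
    have e3 : d ^ 2 / (N + 1) * N =
        ∫ v, d ^ 2 / (N + 1) * (jap v ^ (-(2 * (γ - 1))) * w v ^ 2) := by
      rw [integral_const_mul, ← hN]
    rw [e1, e2, e3, ← integral_add ((rd_w _ hu).cmul _).integrable ((rd_w _ hw).cmul _).integrable]
    apply integral_mono ((hu.mul hw.tg).cmul _).integrable
      (((rd_w _ hu).cmul _).add ((rd_w _ hw).cmul _)).integrable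
    intro v
    simp only
    have hp := Real.rpow_pos_of_pos (jap_pos v) (2 * (γ - 1))
    rw [Real.rpow_neg (jap_pos v).le]
    generalize jap v ^ (2 * (γ - 1)) = p at *
    have hk : 0 ≤ ((N + 1) * p * u v - d * w v) ^ 2 / ((N + 1) * p) := by positivity
    have : ((N + 1) * p * u v - d * w v) ^ 2 / ((N + 1) * p) =
      (N + 1) * (p * u v ^ 2) + d ^ 2 / (N + 1) * (p⁻¹ * w v ^ 2) - 2 * d * (u v * w v) := by
      field_simp
      ring
    linarith
  have h2 : d ^ 2 / (N + 1) * N ≤ d ^ 2 := by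
    rw [div_mul_eq_mul_div, div_le_iff₀ (by linarith)]
    nlinarith [sq_nonneg d]
  nlinarith

/-- Coercivity of the linearized Fokker–Planck operator. -/
theorem coercivity_of_L (γ : ℝ) (hγ : 0 < γ) (Φ0 : ℝ)
    (hM : ∫ v : V3, Real.exp (-(Phi γ Φ0 v)) = 1) :
    ∃ ν0 : ℝ, 0 < ν0 ∧ ∀ g : SchwartzMap V3 ℝ,
      -(∫ v : V3, Lop γ (fun w => g w) v * g v) ≥
        ν0 * ((∫ v : V3, jap v ^ (2 * (γ - 1)) * P1 γ Φ0 (fun w => g w) v ^ 2) +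
          ∫ v : V3, ‖gradient (P1 γ Φ0 fun w => g w) v‖ ^ 2) := by
  have hm := nice_sqrtM γ Φ0 hγ
  have hM' : ∫ v, sqrtM γ Φ0 v ^ 2 = 1 := by
    rw [← hM]; congr 1; funext v; unfold sqrtM
    rw [← Real.exp_nat_mul]; congr 1; push_cast; ring
  obtain ⟨R, hR, C, hC, hW⟩ := WW_lower γ hγ
  obtain ⟨K, hK, hloc⟩ := local_est γ Φ0 hγ R hR
  set N := ∫ v, jap v ^ (-(2 * (γ - 1))) * sqrtM γ Φ0 v ^ 2 with hN
  have hN0 : 0 ≤ N := w_nonneg _ _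
  have hSm : 0 ≤ SS γ (sqrtM γ Φ0) := add_nonneg (w_nonneg _ _) (g_nonneg _)
  set Q := (2 + 2 * (N + 1) * SS γ (sqrtM γ Φ0)) * (8 * (1 + C * K)) with hQ
  have hQ0 : 0 < Q := by positivity
  refine ⟨1 / Q, by positivity, fun g => ?_⟩
  have hg := nice_schwartz g
  rw [L_eq]
  set G : V3 → ℝ := fun v => g v with hG
  obtain ⟨c, hc⟩ := hloc G hg
  set u : V3 → ℝ := fun v => G v - c * sqrtM γ Φ0 v with hu'
  have hu : Nice u := hg.lin hm c
  have hEE : EE γ u = EE γ G := EE_shift γ Φ0 hγ hg c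
  set B := Metric.closedBall (0:V3) R with hB
  have hBm : MeasurableSet B := Metric.isClosed_closedBall.measurableSet
  -- lower bound for u
  have hlow : (1/8) * (∫ v, jap v ^ (2 * (γ - 1)) * u v ^ 2) - C * ∫ v in B, u v ^ 2 ≤
      ∫ v, WW γ v * u v ^ 2 := by
    have i2 : Integrable (B.indicator fun v => u v ^ 2) :=
      (rd_sq hu.rd).integrable.indicator hBm
    rw [← integral_indicator hBm, ← integral_const_mul, ← integral_const_mul,
      ← integral_sub ((rd_w _ hu.rd).cmul _).integrable (i2.const_mul C)]
    apply integral_mono (((rd_w _ hu.rd).cmul _).integrable.sub (i2.const_mul C))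
    · have := (rd_sq hu.rd).mul (tg_WW γ)
      simpa only [mul_comm] using this.integrable
    intro v
    have := mul_le_mul_of_nonneg_right (hW v) (sq_nonneg (u v))
    refine le_trans (le_of_eq ?_) this
    by_cases hv : v ∈ B
    · simp [hv]; ring
    · simp [hv]; ring
  have hSu : SS γ u ≤ 8 * (1 + C * K) * EE γ G := by
    have h1 := EE_eq γ hu
    have h2 := g_nonneg u
    have h3 := w_nonneg (2 * (γ - 1)) u
    have h4 := mul_le_mul_of_nonneg_left hc hC
    rw [hEE] at h1
    unfold SS
    nlinarith
  set d := ∫ v, u v * sqrtM γ Φ0 v with hd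
  have hdc : d = (∫ v, G v * sqrtM γ Φ0 v) - c := by
    have : ∀ v, u v * sqrtM γ Φ0 v = G v * sqrtM γ Φ0 v - c * sqrtM γ Φ0 v ^ 2 := by
      intro v; simp only [hu']; ring
    rw [hd]; simp_rw [this]
    rw [integral_sub (hg.rd.mul hm.rd.tg).integrable ((rd_sq hm.rd).cmul c).integrable,
      integral_const_mul, hM', mul_one]
  have hP : P1 γ Φ0 G = fun v => u v - d * sqrtM γ Φ0 v := by
    funext v
    unfold P1 P0
    rw [hdc]; simp only [hu']; ring
  have hd2 : d ^ 2 ≤ (N + 1) * SS γ u := by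
    have h1 := cs γ hu.rd hm.rd
    have h2 := g_nonneg u
    refine h1.trans ?_
    unfold SS
    apply mul_le_mul_of_nonneg_left _ (by linarith)
    linarith
  have hfin : SS γ (P1 γ Φ0 G) ≤ Q * EE γ G := by
    rw [hP]
    refine (SS_lin γ hu hm d).trans ?_
    have h1 := mul_le_mul_of_nonneg_right hd2 hSm
    calc 2 * SS γ u + 2 * d ^ 2 * SS γ (sqrtM γ Φ0)
        ≤ (2 + 2 * (N + 1) * SS γ (sqrtM γ Φ0)) * SS γ u := by nlinarith
      _ ≤ (2 + 2 * (N + 1) * SS γ (sqrtM γ Φ0)) * (8 * (1 + C * K) * EE γ G) := by gcongr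
      _ = _ := by rw [hQ]; ring
  simp_rw [norm_fderiv_sq]
  change 1 / Q * SS γ (P1 γ Φ0 G) ≤ EE γ G
  rw [div_mul_eq_mul_div, one_mul, div_le_iff₀ hQ0]
  linarith
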